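/- Let F be a finite group with at least two elements, let G = ℤ ≀ F, and let μ be a symmetric, non-degenerate, finitely supported probability measure on G. Under the product measure μ^{⊗n} on Gⁿ, write X_n = s₁·s₂···s_n = (x_n, f_n) with x_n ∈ ℤ and f_n : ℤ → F finitely supported. Then: (1) for every ε > 0 there exists ε₁ > 0 such that for all sufficiently large n, with μ^{⊗n}-probability at least 1 − ε, the smallest interval containing the support of f_n contains the interval [−ε₁·√n, ε₁·√n]; (2) for every ε > 0 there exists ε₁ > 0 such that for all sufficiently large n, with μ^{⊗n}-probability at least 1 − ε, the smallest interval containing the support of f_n contains the interval [x_n − ε₁·√n, x_n + ε₁·√n]. -/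

import Mathlib

noncomputable section
open Filter
open scoped Classical

/-- Convolution of two measures (as real-valued functions) on a group:
`(μ * ν)(g) = Σ_h μ(h) ν(h⁻¹ g)`. -/
def conv {G : Type*} [Group G] (μ ν : G → ℝ) : G → ℝ :=
  fun g => ∑' h : G, μ h * ν (h⁻¹ * g)

/-- `n`-fold convolution power; `convPow μ 0` is the point mass at the identity. -/
def convPow {G : Type*} [Group G] (μ : G → ℝ) : ℕ → G → ℝ
  | 0 => fun g => if g = 1 then 1 else 0
  | n + 1 => conv μ (convPow μ n)

/-- Measure of a subset: `μ(A) = Σ_{x ∈ A} μ(x)`. -/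
def measOf {G : Type*} (μ : G → ℝ) (A : Set G) : ℝ := ∑' x : A, μ x

/-- Word length of `g` with respect to `S ∪ S⁻¹`: the least `k` such that `g` is a
product of `k` elements of `S ∪ S⁻¹`. -/
def wordLength {G : Type*} [Group G] (S : Set G) (g : G) : ℕ :=
  sInf {k | ∃ l : List G, l.length = k ∧ (∀ x ∈ l, x ∈ S ∨ x⁻¹ ∈ S) ∧ l.prod = g}

/-- The group of finitely supported functions `A → F` (pointwise multiplication), as a
subgroup of the product group. -/
def FinMulSupp (A : Type*) (F : Type*) [Group F] : Subgroup (A → F) where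
  carrier := {f | (Function.mulSupport f).Finite}
  one_mem' := by simp [Function.mulSupport_one]
  mul_mem' := by
    intro f g hf hg
    exact (hf.union hg).subset (Function.mulSupport_mul f g)
  inv_mem' := by
    intro f hf
    simpa [Function.mulSupport_inv] using hf

/-- The shift automorphism of `FinMulSupp A F` associated to `z : A`:
`(z · f)(x) = f(x - z)`. -/
def shiftEquiv {A : Type*} [AddCommGroup A] {F : Type*} [Group F] (z : A) :
    FinMulSupp A F ≃* FinMulSupp A F where
  toFun f := ⟨fun x => f.1 (x - z), by
    refine (f.2.image (fun y => y + z)).subset ?_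
    intro x hx
    exact ⟨x - z, hx, by simp⟩⟩
  invFun f := ⟨fun x => f.1 (x + z), by
    refine (f.2.image (fun y => y - z)).subset ?_
    intro x hx
    exact ⟨x + z, hx, by simp⟩⟩
  left_inv f := by
    apply Subtype.ext
    funext x
    simp
  right_inv f := by
    apply Subtype.ext
    funext x
    simp
  map_mul' f g := rfl

/-- The shift action of `A` on `FinMulSupp A F`, as a homomorphism
`Multiplicative A →* MulAut (FinMulSupp A F)`. -/
def shiftHom (A : Type*) [AddCommGroup A] (F : Type*) [Group F] :
    Multiplicative A →* MulAut (FinMulSupp A F) where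
  toFun z := shiftEquiv (Multiplicative.toAdd z)
  map_one' := by
    apply MulEquiv.ext
    intro f
    apply Subtype.ext
    funext x
    simp [shiftEquiv]
  map_mul' z w := by
    apply MulEquiv.ext
    intro f
    apply Subtype.ext
    funext x
    simp [shiftEquiv, MulAut.mul_apply, sub_sub]

/-- The wreath product `A ≀ F` (with acting group `A`): the semidirect product of the group
of finitely supported functions `A → F` with `A` acting by shifts. -/
abbrev Wreath (A : Type*) [AddCommGroup A] (F : Type*) [Group F] : Type _ :=
  FinMulSupp A F ⋊[shiftHom A F] Multiplicative A

/-- The function supported at `0 : A` with value `f` there. -/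
def deltaF {A : Type*} [AddCommGroup A] {F : Type*} [Group F] (f : F) : FinMulSupp A F :=
  ⟨fun x => if x = 0 then f else 1, by
    refine (Set.finite_singleton (0 : A)).subset ?_
    intro x hx
    by_contra hx0
    simp only [Function.mem_mulSupport] at hx
    simp only [Set.mem_singleton_iff] at hx0
    simp [hx0] at hx⟩

/-- Probability of an event under the product measure `μ^{⊗n}` on `Gⁿ` (the distribution of
the increments `(s₁, …, sₙ)` of the random walk). -/
def prodProb {G : Type*} (μ : G → ℝ) (n : ℕ) (E : Set (Fin n → G)) : ℝ :=
  ∑' s : E, ∏ i, μ ((s : Fin n → G) i)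

/-- The position of the random walk after `k` of the `n` steps: `X_k = s₁ ⋯ s_k`. -/
def walkPos {G : Type*} [Group G] {n : ℕ} (s : Fin n → G) (k : ℕ) : G :=
  ((List.ofFn s).take k).prod

section Markov
variable {G : Type*} [Group G]

/-- Markov operator of the right random walk. -/
def TT (μ : G → ℝ) (S : Finset G) (φ : G → ℝ) (X : G) : ℝ := ∑ g ∈ S, μ g * φ (X * g)

/-- Left version. -/
def RR (μ : G → ℝ) (S : Finset G) (φ : G → ℝ) (X : G) : ℝ := ∑ g ∈ S, μ g * φ (g * X)

/-- Iterates of the Markov operator. -/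
def TP (μ : G → ℝ) (S : Finset G) : ℕ → (G → ℝ) → G → ℝ
  | 0, φ => φ
  | n + 1, φ => TT μ S (TP μ S n φ)

def RP (μ : G → ℝ) (S : Finset G) : ℕ → (G → ℝ) → G → ℝ
  | 0, φ => φ
  | n + 1, φ => RR μ S (RP μ S n φ)

/-- Indicator. -/
def ind (Q : G → Prop) (X : G) : ℝ := if Q X then 1 else 0

variable {μ : G → ℝ} {S : Finset G}

lemma ind_nonneg (Q : G → Prop) (X : G) : 0 ≤ ind Q X := by
  unfold ind; split_ifs <;> norm_num

lemma ind_le_one (Q : G → Prop) (X : G) : ind Q X ≤ 1 := by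
  unfold ind; split_ifs <;> norm_num

lemma TT_mono (h0 : ∀ g, 0 ≤ μ g) {φ ψ : G → ℝ} (h : ∀ X, φ X ≤ ψ X) (X : G) :
    TT μ S φ X ≤ TT μ S ψ X :=
  Finset.sum_le_sum fun g _ => mul_le_mul_of_nonneg_left (h _) (h0 g)

lemma TP_mono (h0 : ∀ g, 0 ≤ μ g) {φ ψ : G → ℝ} (h : ∀ X, φ X ≤ ψ X) (n : ℕ) (X : G) :
    TP μ S n φ X ≤ TP μ S n ψ X := by
  induction n generalizing X with
  | zero => exact h X
  | succ n ih => exact TT_mono h0 ih X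

lemma TP_add (n m : ℕ) (φ : G → ℝ) : TP μ S (n + m) φ = TP μ S n (TP μ S m φ) := by
  induction n with
  | zero => simp [TP]
  | succ n ih => rw [Nat.add_right_comm]; simp only [TP]; rw [ih]

lemma TP_const (h1 : ∑ g ∈ S, μ g = 1) (n : ℕ) (c : ℝ) (X : G) :
    TP μ S n (fun _ => c) X = c := by
  induction n generalizing X with
  | zero => rfl
  | succ n ih => simp only [TP, TT, ih, ← Finset.sum_mul, h1, one_mul]

lemma TP_fadd (n : ℕ) (φ ψ : G → ℝ) (X : G) :
    TP μ S n (fun X => φ X + ψ X) X = TP μ S n φ X + TP μ S n ψ X := by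
  induction n generalizing X with
  | zero => rfl
  | succ n ih => simp only [TP, TT, ih, mul_add, Finset.sum_add_distrib]

lemma TP_fsum {ι : Type*} (I : Finset ι) (n : ℕ) (φ : ι → G → ℝ) (X : G) :
    TP μ S n (fun X => ∑ i ∈ I, φ i X) X = ∑ i ∈ I, TP μ S n (φ i) X := by
  induction n generalizing X with
  | zero => rfl
  | succ n ih =>
    simp only [TP, TT, ih, Finset.mul_sum]
    exact Finset.sum_comm

lemma TP_nonneg (h0 : ∀ g, 0 ≤ μ g) {φ : G → ℝ} (h : ∀ X, 0 ≤ φ X) (n : ℕ) (X : G) :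
    0 ≤ TP μ S n φ X := by
  induction n generalizing X with
  | zero => exact h X
  | succ n ih => exact Finset.sum_nonneg fun g _ => mul_nonneg (h0 g) (ih _)

lemma TR_comm (φ : G → ℝ) : TT μ S (RR μ S φ) = RR μ S (TT μ S φ) := by
  funext X
  simp only [TT, RR, Finset.mul_sum]
  rw [Finset.sum_comm]
  refine Finset.sum_congr rfl fun g _ => Finset.sum_congr rfl fun h _ => ?_
  rw [mul_assoc]; ring

lemma TRP_comm (n : ℕ) (φ : G → ℝ) : TT μ S (RP μ S n φ) = RP μ S n (TT μ S φ) := by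
  induction n with
  | zero => rfl
  | succ n ih => simp only [RP]; rw [TR_comm, ih]

lemma TP_succ' (n : ℕ) (φ : G → ℝ) : TP μ S (n + 1) φ = TP μ S n (TT μ S φ) := by
  rw [TP_add]; rfl

lemma TP_eq_RP (n : ℕ) (φ : G → ℝ) : TP μ S n φ 1 = RP μ S n φ 1 := by
  induction n generalizing φ with
  | zero => rfl
  | succ n ih =>
    rw [TP_succ', ih, ← TRP_comm]
    simp only [RP, TT, RR, one_mul, mul_one]

lemma TP_inv (hS : ∀ g, g ∈ S → g⁻¹ ∈ S) (hsym : ∀ g, μ g = μ g⁻¹) (n : ℕ) (φ : G → ℝ) (X : G) :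
    TP μ S n (fun Y => φ Y⁻¹) X = RP μ S n φ X⁻¹ := by
  induction n generalizing X with
  | zero => rfl
  | succ n ih =>
    simp only [TP, TT, RP, RR, ih]
    refine Finset.sum_nbij' (fun g => g⁻¹) (fun g => g⁻¹) hS hS (by simp) (by simp) ?_
    intro g _
    rw [← hsym g, mul_inv_rev]

lemma TP_inv_one (hS : ∀ g, g ∈ S → g⁻¹ ∈ S) (hsym : ∀ g, μ g = μ g⁻¹) (n : ℕ) (φ : G → ℝ) :
    TP μ S n (fun Y => φ Y⁻¹) 1 = TP μ S n φ 1 := by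
  rw [TP_inv hS hsym, inv_one, TP_eq_RP]

lemma TP_eq_sum (n : ℕ) (φ : G → ℝ) (X : G) :
    TP μ S n φ X = ∑ s : Fin n → S, (∏ i, μ (s i)) * φ (X * (List.ofFn fun i => (s i : G)).prod) := by
  induction n generalizing X with
  | zero => simp [TP]
  | succ n ih =>
    rw [← (Fin.consEquiv fun _ : Fin (n + 1) => S).sum_comp, Fintype.sum_prod_type]
    simp only [TP, TT, ih]
    rw [← Finset.sum_coe_sort S]
    refine Finset.sum_congr rfl fun g _ => ?_
    rw [Finset.mul_sum]
    refine Finset.sum_congr rfl fun s _ => ?_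
    simp [Fin.consEquiv, Fin.prod_univ_succ, List.ofFn_succ, mul_assoc]

lemma prodProb_eq (hS : ∀ g, μ g ≠ 0 → g ∈ S) (n : ℕ) (Q : G → Prop) :
    prodProb μ n {s : Fin n → G | Q (walkPos s n)} = TP μ S n (ind Q) 1 := by
  rw [TP_eq_sum]
  unfold prodProb
  rw [tsum_subtype {s : Fin n → G | Q (walkPos s n)} (fun s => ∏ i, μ (s i))]
  have hinj : Function.Injective (fun (s : Fin n → S) (i : Fin n) => (s i : G)) := by
    intro s t h
    funext i
    exact Subtype.ext (congrFun h i)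
  rw [← hinj.tsum_eq, tsum_fintype]
  · refine Finset.sum_congr rfl fun s _ => ?_
    simp only [Set.indicator, Set.mem_setOf_eq, ind, walkPos, one_mul]
    rw [List.take_of_length_le (by simp)]
    split_ifs <;> simp
  · intro s hs
    have h2 : ∏ i, μ (s i) ≠ 0 := by
      intro h
      apply hs
      simp [Set.indicator, h]
    rw [Finset.prod_ne_zero_iff] at h2
    exact ⟨fun i => ⟨s i, hS _ (h2 i (Finset.mem_univ i))⟩, rfl⟩

/-- non-hitting probability -/
def pn (μ : G → ℝ) (S : Finset G) (d : G → ℝ) (y : ℝ) : ℕ → G → ℝ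
  | 0, X => if d X < y then 1 else 0
  | n + 1, X => if d X < y then TT μ S (pn μ S d y n) X else 0

/-- probability to hit and end in `A` -/
def hn (μ : G → ℝ) (S : Finset G) (d : G → ℝ) (y : ℝ) (φ : G → ℝ) : ℕ → G → ℝ
  | 0, X => if d X < y then 0 else φ X
  | n + 1, X => if d X < y then TT μ S (hn μ S d y φ n) X else TP μ S (n + 1) φ X

lemma split_hit (h0 : ∀ g, 0 ≤ μ g) (d : G → ℝ) (y : ℝ) (φ : G → ℝ) (hφ : ∀ X, φ X ≤ 1)
    (n : ℕ) (X : G) : TP μ S n φ X ≤ hn μ S d y φ n X + pn μ S d y n X := by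
  induction n generalizing X with
  | zero => simp only [TP, hn, pn]; split_ifs <;> simp [hφ X]
  | succ n ih =>
    simp only [hn, pn]
    split_ifs
    · calc _ ≤ TT μ S (fun X => hn μ S d y φ n X + pn μ S d y n X) X := TT_mono h0 ih X
        _ = _ := by simp only [TT, mul_add, Finset.sum_add_distrib]
    · simp

lemma pn_le_one (h0 : ∀ g, 0 ≤ μ g) (h1 : ∑ g ∈ S, μ g = 1) (d : G → ℝ) (y : ℝ) (n : ℕ) (X : G) :
    pn μ S d y n X ≤ 1 := by
  induction n generalizing X with
  | zero => simp only [pn]; split_ifs <;> norm_num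
  | succ n ih =>
    simp only [pn]; split_ifs
    · calc _ ≤ TT μ S (fun _ => 1) X := TT_mono h0 ih X
        _ = 1 := by simp [TT, h1]
    · norm_num

lemma pn_bound (h0 : ∀ g, 0 ≤ μ g) (h1 : ∑ g ∈ S, μ g = 1) (d : G → ℝ)
    (hd : ∀ X Y, d (X * Y) = d X + d Y) (C : ℝ) (hC : ∀ g ∈ S, |d g| ≤ C)
    (hm : ∑ g ∈ S, μ g * d g = 0) (v : ℝ) (hv : ∑ g ∈ S, μ g * d g ^ 2 = v)
    (hv0 : 0 < v)
    (y β : ℝ) (hβ : 0 < β) (hβC : β * C ≤ 1) (k : ℕ) (hk : k * (β ^ 2 * v) ≤ 1) (X : G)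
    (u : ℝ) (hu : u = β * (y + C - d X)) (hu0 : 0 ≤ u) (hu1 : u ≤ 5 / 2) :
    pn μ S d y k X ≤ 3 * u - u ^ 2 + 1 - k * (β ^ 2 * v) := by
  induction k generalizing X u with
  | zero =>
    have := pn_le_one h0 h1 d y 0 X
    push_cast
    nlinarith
  | succ k ih =>
    have hbv : 0 < β ^ 2 * v := by positivity
    push_cast at hk ⊢
    have ih' := ih (by linarith)
    by_cases hx : d X < y
    · by_cases hu2 : 3 / 2 ≤ u
      · have := pn_le_one h0 h1 d y (k + 1) X
        nlinarith
      · simp only [pn, hx, if_true]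
        calc TT μ S (pn μ S d y k) X
            ≤ ∑ g ∈ S, μ g * (3 * (u - β * d g) - (u - β * d g) ^ 2 + 1 - k * (β ^ 2 * v)) := by
              refine Finset.sum_le_sum fun g hg => mul_le_mul_of_nonneg_left ?_ (h0 g)
              have hg2 := abs_le.1 (hC g hg)
              apply ih'
              · rw [hu, hd]; ring
              · have : 0 ≤ β * (y - d X) := mul_nonneg hβ.le (by linarith)
                have : β * d g ≤ β * C := mul_le_mul_of_nonneg_left hg2.2 hβ.le
                rw [hu]; nlinarith
              · have : β * (- d g) ≤ β * C := mul_le_mul_of_nonneg_left (by linarith) hβ.le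
                nlinarith
          _ = (3 * u - u ^ 2 + 1 - k * (β ^ 2 * v)) * ∑ g ∈ S, μ g
              + (2 * u * β - 3 * β) * ∑ g ∈ S, μ g * d g
              - β ^ 2 * ∑ g ∈ S, μ g * d g ^ 2 := by
              rw [Finset.mul_sum, Finset.mul_sum, Finset.mul_sum, ← Finset.sum_add_distrib,
                ← Finset.sum_sub_distrib]
              refine Finset.sum_congr rfl fun g _ => ?_
              ring
          _ ≤ _ := by rw [h1, hm, hv]; apply le_of_eq; ring
    · simp only [pn, hx, if_false]
      nlinarith

lemma pn_final (h0 : ∀ g, 0 ≤ μ g) (h1 : ∑ g ∈ S, μ g = 1) (d : G → ℝ)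
    (hd : ∀ X Y, d (X * Y) = d X + d Y) (C : ℝ) (hC : ∀ g ∈ S, |d g| ≤ C) (hC0 : 0 ≤ C)
    (hm : ∑ g ∈ S, μ g * d g = 0) (v : ℝ) (hv : ∑ g ∈ S, μ g * d g ^ 2 = v)
    (hv0 : 0 < v) (y : ℝ) (hy : 0 ≤ y) (n : ℕ) (hn : 0 < n) (hnC : C ≤ Real.sqrt (v * n)) :
    pn μ S d y n 1 ≤ 3 * ((y + C) / Real.sqrt (v * n)) := by
  have hn' : (0 : ℝ) < n := by exact_mod_cast hn
  have hs : 0 < Real.sqrt (v * n) := Real.sqrt_pos.2 (by positivity)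
  have hd1 : d 1 = 0 := by have := hd 1 1; simp at this; exact this
  have hu0 : 0 ≤ (y + C) / Real.sqrt (v * n) := by positivity
  by_cases hu : (y + C) / Real.sqrt (v * n) ≤ 5 / 2
  · have hk : (n : ℝ) * ((1 / Real.sqrt (v * n)) ^ 2 * v) = 1 := by
      rw [div_pow, Real.sq_sqrt (by positivity)]; field_simp
    have := pn_bound h0 h1 d hd C hC hm v hv hv0 y (1 / Real.sqrt (v * n)) (by positivity)
      (by rw [one_div, inv_mul_le_iff₀ hs]; linarith) n hk.le 1 ((y + C) / Real.sqrt (v * n))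
      (by rw [hd1]; ring) hu0 hu
    rw [hk] at this
    nlinarith [sq_nonneg ((y + C) / Real.sqrt (v * n))]
  · have := pn_le_one h0 h1 d y n 1
    linarith

lemma hn_bound (h0 : ∀ g, 0 ≤ μ g) (d : G → ℝ)
    (hd : ∀ X Y, d (X * Y) = d X + d Y) (C : ℝ) (hC : ∀ g ∈ S, |d g| < C)
    (y : ℝ) (A B : G → Prop) (w : G) (m : ℕ) (c : ℝ) (hc : 0 < c)
    (hw : ∀ φ : G → ℝ, (∀ X, 0 ≤ φ X) → ∀ X, c * φ (X * w) ≤ TP μ S m φ X)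
    (hAB : ∀ Y p, y ≤ d Y → d Y < y + C → A (Y * p) → B (Y * w * p))
    (n : ℕ) (X : G) (hX : d X < y + C) :
    c * hn μ S d y (ind A) n X ≤ TP μ S (m + n) (ind B) X := by
  have key : ∀ n X, y ≤ d X → d X < y + C →
      c * TP μ S n (ind A) X ≤ TP μ S (m + n) (ind B) X := by
    intro n X h1 h2
    rw [TP_add]
    refine le_trans (mul_le_mul_of_nonneg_left ?_ hc.le) (hw _ (fun X => TP_nonneg h0 (ind_nonneg B) n X) X)
    rw [TP_eq_sum, TP_eq_sum]
    refine Finset.sum_le_sum fun s _ => mul_le_mul_of_nonneg_left ?_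
      (Finset.prod_nonneg fun i _ => h0 _)
    unfold ind
    split_ifs with ha hb
    · exact le_rfl
    · exact absurd (hAB X _ h1 h2 ha) hb
    · norm_num
    · norm_num
  induction n generalizing X with
  | zero =>
    simp only [hn]
    split_ifs with h
    · rw [mul_zero]; exact TP_nonneg h0 (ind_nonneg B) _ X
    · exact key 0 X (not_lt.1 h) hX
  | succ n ih =>
    simp only [hn]
    split_ifs with h
    · rw [← Nat.add_assoc]
      simp only [TP, TT]
      rw [Finset.mul_sum]
      refine Finset.sum_le_sum fun g hg => ?_
      have := ih (X * g) (by rw [hd]; have := (abs_lt.1 (hC g hg)).2; linarith)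
      calc _ = μ g * (c * hn μ S d y (ind A) n (X * g)) := by ring
        _ ≤ _ := mul_le_mul_of_nonneg_left this (h0 g)
    · exact key (n + 1) X (not_lt.1 h) hX

lemma exists_insert (h0 : ∀ g, 0 ≤ μ g) (hS : ∀ g, μ g ≠ 0 → g ∈ S)
    (hnd : Subsemigroup.closure (Function.support μ) = ⊤) (w : G) :
    ∃ (m : ℕ) (c : ℝ), 0 < c ∧ ∀ φ : G → ℝ, (∀ X, 0 ≤ φ X) → ∀ X,
      c * φ (X * w) ≤ TP μ S m φ X := by
  have hw : w ∈ Subsemigroup.closure (Function.support μ) := by rw [hnd]; trivial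
  induction hw using Subsemigroup.closure_induction with
  | mem g hg =>
    refine ⟨1, μ g, lt_of_le_of_ne (h0 g) (Ne.symm hg), fun φ hφ X => ?_⟩
    exact Finset.single_le_sum (f := fun g => μ g * φ (X * g))
      (fun i _ => mul_nonneg (h0 i) (hφ _)) (hS g hg)
  | mul a b _ _ ha hb =>
    obtain ⟨m, c, hc, h⟩ := ha
    obtain ⟨m', c', hc', h'⟩ := hb
    refine ⟨m + m', c * c', mul_pos hc hc', fun φ hφ X => ?_⟩
    rw [TP_add]
    refine le_trans ?_ (h _ (fun X => TP_nonneg h0 hφ m' X) X)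
    rw [mul_assoc, ← mul_assoc X]
    exact mul_le_mul_of_nonneg_left (h' φ hφ (X * a)) hc.le

end Markov

section Wr
variable {F : Type*} [Group F]

/-- The `ℤ` coordinate, as a real. -/
def px (X : Wreath ℤ F) : ℝ := ((Multiplicative.toAdd X.right : ℤ) : ℝ)

lemma px_mul (X Y : Wreath ℤ F) : px (X * Y) = px X + px Y := by
  simp [px]

lemma left_mul_apply (X Y : Wreath ℤ F) (v : ℤ) :
    ((X * Y).left : ℤ → F) v = (X.left : ℤ → F) v * (Y.left : ℤ → F) (v - Multiplicative.toAdd X.right) := by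
  rfl

/-- no support beyond `L` in direction `sg`. -/
def AA (sg L : ℝ) (X : Wreath ℤ F) : Prop := ∀ v : ℤ, (X.left : ℤ → F) v ≠ 1 → sg * v < L

/-- the extremal support point lies in the window `[y, y + C)`. -/
def BB (sg C y : ℝ) (X : Wreath ℤ F) : Prop :=
  ∃ v : ℤ, (X.left : ℤ → F) v ≠ 1 ∧ y ≤ sg * v ∧ sg * v < y + C ∧
    ∀ u : ℤ, (X.left : ℤ → F) u ≠ 1 → sg * u ≤ sg * v

lemma AA_to_BB (a : F) (ha : a ≠ 1) (sg L C y : ℝ) (hLy : L ≤ y) (Y p : Wreath ℤ F)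
    (h1 : y ≤ sg * px Y) (h2 : sg * px Y < y + C) (hA : AA sg L (Y * p)) :
    BB sg C y (Y * SemidirectProduct.inl (deltaF a) * p) := by
  have hval : ∀ u : ℤ, ((Y * SemidirectProduct.inl (deltaF a) * p).left : ℤ → F) u =
      (Y.left : ℤ → F) u * (if u - Multiplicative.toAdd Y.right = 0 then a else 1) *
        (p.left : ℤ → F) (u - Multiplicative.toAdd Y.right) := by
    intro u
    rw [left_mul_apply, left_mul_apply]
    simp [deltaF]
  refine ⟨Multiplicative.toAdd Y.right, ?_, h1, h2, ?_⟩
  · rw [hval]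
    have h3 : ((Y * p).left : ℤ → F) (Multiplicative.toAdd Y.right) = 1 := by
      by_contra h
      have := hA _ h
      unfold px at h1
      linarith
    rw [left_mul_apply] at h3
    simp only [sub_self, if_true] at h3 ⊢
    intro h
    apply ha
    rw [eq_inv_of_mul_eq_one_left h3] at h
    rw [mul_assoc, inv_mul_eq_one] at h
    exact mul_eq_right.1 h.symm
  · intro u hu
    by_cases hx : u - Multiplicative.toAdd Y.right = 0
    · rw [sub_eq_zero.1 hx]
    · rw [hval] at hu
      rw [if_neg hx, mul_one, ← left_mul_apply] at hu
      have := hA u hu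
      unfold px at h1
      linarith

lemma BB_sum (sg C L : ℝ) (hC : 0 < C) (N : ℕ) (X : Wreath ℤ F) :
    ∑ j ∈ Finset.range N, ind (BB sg C (L + j * C)) X ≤ 1 := by
  by_cases h : ∃ j ∈ Finset.range N, BB sg C (L + j * C) X
  · obtain ⟨j, hj, hB⟩ := h
    rw [Finset.sum_eq_single_of_mem j hj]
    · exact ind_le_one _ _
    · intro i _ hij
      unfold ind
      rw [if_neg]
      intro hB'
      apply hij
      obtain ⟨v, hv, h1, h2, h3⟩ := hB
      obtain ⟨v', hv', h1', h2', h3'⟩ := hB'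
      have e1 := h3 v' hv'
      have e2 := h3' v hv
      have l1 : (i : ℝ) < j + 1 := by
        by_contra hcon
        push Not at hcon
        nlinarith
      have l2 : (j : ℝ) < i + 1 := by
        by_contra hcon
        push Not at hcon
        nlinarith
      have l1' : i < j + 1 := by exact_mod_cast l1
      have l2' : j < i + 1 := by exact_mod_cast l2
      omega
  · rw [Finset.sum_eq_zero]
    · norm_num
    · intro j hj
      unfold ind
      rw [if_neg]
      intro hB
      exact h ⟨j, hj, hB⟩

lemma onesided [Nontrivial F] (μ : Wreath ℤ F → ℝ) (S : Finset (Wreath ℤ F))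
    (h0 : ∀ g, 0 ≤ μ g) (h1 : ∑ g ∈ S, μ g = 1) (hS : ∀ g, μ g ≠ 0 → g ∈ S)
    (hSi : ∀ g, g ∈ S → g⁻¹ ∈ S) (hsym : ∀ g, μ g = μ g⁻¹)
    (hnd : Subsemigroup.closure (Function.support μ) = ⊤) (ε : ℝ) (hε : 0 < ε) :
    ∃ ε₁ > (0 : ℝ), ∃ N : ℕ, ∀ n ≥ N, ∀ sg : ℝ, sg ^ 2 = 1 →
      TP μ S n (ind (AA sg (ε₁ * Real.sqrt n))) 1 ≤ ε := by
  obtain ⟨a, ha⟩ := exists_ne (1 : F)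
  obtain ⟨m, c, hc, hw⟩ := exists_insert h0 hS hnd (SemidirectProduct.inl (deltaF a))
  -- range
  obtain ⟨C, hC0, hC⟩ : ∃ C : ℝ, 0 < C ∧ ∀ g ∈ S, |px g| < C := by
    refine ⟨∑ g ∈ S, |px g| + 1, by positivity, fun g hg => ?_⟩
    have := Finset.single_le_sum (f := fun g : Wreath ℤ F => |px g|)
      (fun i _ => abs_nonneg _) hg
    linarith
  have hm : ∑ g ∈ S, μ g * px g = 0 := by
    have : ∑ g ∈ S, μ g * px g = ∑ g ∈ S, -(μ g * px g) := by
      refine Finset.sum_nbij' (fun g => g⁻¹) (fun g => g⁻¹) hSi hSi (by simp) (by simp) ?_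
      intro g _
      rw [← hsym g]
      simp [px]
    rw [Finset.sum_neg_distrib] at this
    linarith
  obtain ⟨v, hv⟩ : ∃ v, ∑ g ∈ S, μ g * px g ^ 2 = v := ⟨_, rfl⟩
  have hv0 : 0 < v := by
    have hnn : ∀ g ∈ S, 0 ≤ μ g * px g ^ 2 := fun g _ => mul_nonneg (h0 g) (sq_nonneg _)
    rw [← hv]
    refine lt_of_le_of_ne (Finset.sum_nonneg hnn) fun h => ?_
    have hz := (Finset.sum_eq_zero_iff_of_nonneg hnn).1 h.symm
    have : ∀ g : Wreath ℤ F, px g = 0 := by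
      intro g
      have hg : g ∈ Subsemigroup.closure (Function.support μ) := by rw [hnd]; trivial
      induction hg using Subsemigroup.closure_induction with
      | mem g hg =>
        have := hz g (hS g hg)
        rcases mul_eq_zero.1 this with h | h
        · exact absurd h hg
        · exact pow_eq_zero_iff (two_ne_zero) |>.1 h
      | mul a b _ _ ha hb => rw [px_mul, ha, hb, add_zero]
    have := this (SemidirectProduct.inr (Multiplicative.ofAdd (1 : ℤ)))
    simp [px] at this
  obtain ⟨N, hN⟩ := exists_nat_gt (2 / (c * ε))
  have hNpos : (0 : ℝ) < N := lt_trans (by positivity) hN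
  have hsv : 0 < Real.sqrt v := Real.sqrt_pos.2 hv0
  obtain ⟨M, hM⟩ := exists_nat_gt ((12 * (N + 1) * C / (ε * Real.sqrt v)) ^ 2 + (C / Real.sqrt v) ^ 2)
  refine ⟨ε * Real.sqrt v / 12, by positivity, M + 1, fun n hn sg hsg => ?_⟩
  have hnM : (M : ℝ) ≤ n := by exact_mod_cast (by omega : M ≤ n)
  have hn0 : 0 < n := by omega
  have hn' : (0 : ℝ) < n := by exact_mod_cast hn0
  have hsn : 0 < Real.sqrt n := Real.sqrt_pos.2 hn'
  have q1 : 12 * (N + 1) * C / (ε * Real.sqrt v) ≤ Real.sqrt n :=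
    Real.le_sqrt_of_sq_le (by nlinarith [sq_nonneg (C / Real.sqrt v)])
  have q2 : C / Real.sqrt v ≤ Real.sqrt n :=
    Real.le_sqrt_of_sq_le (by nlinarith [sq_nonneg (12 * (N + 1) * C / (ε * Real.sqrt v))])
  have hsq : Real.sqrt (v * n) = Real.sqrt v * Real.sqrt n := Real.sqrt_mul hv0.le _
  set L := ε * Real.sqrt v / 12 * Real.sqrt n with hL
  have hL0 : 0 < L := by positivity
  have habs : |sg| = 1 := by
    rw [← sq_abs] at hsg
    nlinarith [abs_nonneg sg]
  have hC' : ∀ g ∈ S, |sg * px g| < C := by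
    intro g hg
    rw [abs_mul, habs, one_mul]; exact hC g hg
  have hd : ∀ X Y : Wreath ℤ F, sg * px (X * Y) = sg * px X + sg * px Y := by
    intro X Y; rw [px_mul, mul_add]
  have hm' : ∑ g ∈ S, μ g * (sg * px g) = 0 := by
    rw [← mul_zero sg, ← hm, Finset.mul_sum]
    exact Finset.sum_congr rfl fun g _ => by ring
  have hv' : ∑ g ∈ S, μ g * (sg * px g) ^ 2 = v := by
    rw [← hv]
    exact Finset.sum_congr rfl fun g _ => by rw [mul_pow, hsg, one_mul]
  have hone : sg * px (1 : Wreath ℤ F) = 0 := by simp [px]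
  have main : ∀ j ∈ Finset.range N, c * (TP μ S n (ind (AA sg L)) 1 - ε / 2) ≤
      TP μ S (m + n) (ind (BB sg C (L + j * C))) 1 := by
    intro j hj
    have hjN : (j : ℝ) ≤ N := by exact_mod_cast (Finset.mem_range.1 hj).le
    have hjC : (j : ℝ) * C ≤ N * C := mul_le_mul_of_nonneg_right hjN hC0.le
    have hjC0 : 0 ≤ (j : ℝ) * C := by positivity
    have e1 := split_hit (S := S) h0 (fun X => sg * px X) (L + j * C) (ind (AA sg L)) (ind_le_one _) n 1
    have e2 := hn_bound (S := S) h0 (fun X => sg * px X) hd C hC' (L + j * C) (AA sg L)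
      (BB sg C (L + j * C)) _ m c hc hw
      (fun Y p h1 h2 hA => AA_to_BB a ha sg L C _ (by linarith) Y p h1 h2 hA) n 1
      (by simp only [hone]; linarith)
    have e3 := pn_final h0 h1 (fun X => sg * px X) hd C (fun g hg => (hC' g hg).le) hC0.le hm' v hv'
      hv0 (L + j * C) (by linarith) n hn0
      (by rw [hsq]; rw [div_le_iff₀ hsv] at q2; linarith)
    have e4 : 3 * ((L + j * C + C) / Real.sqrt (v * n)) ≤ ε / 2 := by
      rw [hsq, ← mul_div_assoc, div_le_iff₀ (by positivity)]
      rw [div_le_iff₀ (by positivity)] at q1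
      rw [hL]
      nlinarith
    refine le_trans (mul_le_mul_of_nonneg_left ?_ hc.le) e2
    linarith
  have hsum := Finset.sum_le_sum main
  rw [← TP_fsum, Finset.sum_const, Finset.card_range, nsmul_eq_mul] at hsum
  have h2 := TP_mono (S := S) h0 (fun X : Wreath ℤ F => BB_sum sg C L hC0 N X) (m + n) 1
  rw [TP_const h1] at h2
  have h3 := hsum.trans h2
  rw [div_lt_iff₀ (by positivity)] at hN
  by_contra hcon
  push Not at hcon
  have : N * (c * (ε / 2)) < N * (c * (TP μ S n (ind (AA sg L)) 1 - ε / 2)) := by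
    apply mul_lt_mul_of_pos_left _ hNpos
    apply mul_lt_mul_of_pos_left _ hc
    linarith
  nlinarith

/-- The two sided good event. -/
def Good (L : ℝ) (X : Wreath ℤ F) : Prop :=
  (∃ u : ℤ, (X.left : ℤ → F) u ≠ 1 ∧ (u : ℝ) ≤ -L) ∧ (∃ v : ℤ, (X.left : ℤ → F) v ≠ 1 ∧ L ≤ (v : ℝ))

lemma twosided [Nontrivial F] (μ : Wreath ℤ F → ℝ) (S : Finset (Wreath ℤ F))
    (h0 : ∀ g, 0 ≤ μ g) (h1 : ∑ g ∈ S, μ g = 1) (hS : ∀ g, μ g ≠ 0 → g ∈ S)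
    (hSi : ∀ g, g ∈ S → g⁻¹ ∈ S) (hsym : ∀ g, μ g = μ g⁻¹)
    (hnd : Subsemigroup.closure (Function.support μ) = ⊤) (ε : ℝ) (hε : 0 < ε) :
    ∃ ε₁ > (0 : ℝ), ∃ N : ℕ, ∀ n ≥ N,
      1 - ε ≤ TP μ S n (ind (Good (ε₁ * Real.sqrt n))) 1 := by
  obtain ⟨ε₁, he, N, hN⟩ := onesided μ S h0 h1 hS hSi hsym hnd (ε / 2) (by positivity)
  refine ⟨ε₁, he, N, fun n hn => ?_⟩
  have a1 := hN n hn 1 (by norm_num)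
  have a2 := hN n hn (-1) (by norm_num)
  have hp : ∀ X : Wreath ℤ F, (1 : ℝ) ≤ ind (Good (ε₁ * Real.sqrt n)) X +
      (ind (AA 1 (ε₁ * Real.sqrt n)) X + ind (AA (-1) (ε₁ * Real.sqrt n)) X) := by
    intro X
    have n1 := ind_nonneg (Good (ε₁ * Real.sqrt n)) X
    have n2 := ind_nonneg (AA 1 (ε₁ * Real.sqrt n)) X
    have n3 := ind_nonneg (AA (-1) (ε₁ * Real.sqrt n)) X
    by_cases hA : AA 1 (ε₁ * Real.sqrt n) X
    · have : ind (AA 1 (ε₁ * Real.sqrt n)) X = 1 := if_pos hA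
      linarith
    by_cases hB : AA (-1) (ε₁ * Real.sqrt n) X
    · have : ind (AA (-1) (ε₁ * Real.sqrt n)) X = 1 := if_pos hB
      linarith
    have hG : Good (ε₁ * Real.sqrt n) X := by
      unfold AA at hA hB
      push Not at hA hB
      obtain ⟨v, hv, hv'⟩ := hA
      obtain ⟨u, hu, hu'⟩ := hB
      exact ⟨⟨u, hu, by linarith⟩, ⟨v, hv, by linarith⟩⟩
    have : ind (Good (ε₁ * Real.sqrt n)) X = 1 := if_pos hG
    linarith
  have := TP_mono (S := S) h0 hp n 1
  rw [TP_const h1, TP_fadd, TP_fadd] at this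
  linarith

lemma left_inv_apply (X : Wreath ℤ F) (u : ℤ) :
    ((X⁻¹).left : ℤ → F) u = ((X.left : ℤ → F) (u + Multiplicative.toAdd X.right))⁻¹ := by
  have h := left_mul_apply X X⁻¹ (u + Multiplicative.toAdd X.right)
  rw [mul_inv_cancel, add_sub_cancel_right] at h
  exact eq_inv_of_mul_eq_one_right h.symm

end Wr

/-- For a symmetric, non-degenerate, finitely supported probability
measure on `G = ℤ ≀ F`, writing `X_n = (x_n, f_n)` for the position after `n` steps:
(1) with probability at least `1 - ε`, the smallest interval containing the support of
`f_n` contains `[-ε₁ √n, ε₁ √n]`; (2) with probability at least `1 - ε`, it contains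
`[x_n - ε₁ √n, x_n + ε₁ √n]`. -/
theorem stmt14 (F : Type*) [Group F] [Fintype F] [Nontrivial F]
    (μ : Wreath ℤ F → ℝ) (hμ0 : ∀ g, 0 ≤ μ g) (hμ1 : HasSum μ 1)
    (hsym : ∀ g, μ g = μ g⁻¹)
    (hnd : Subsemigroup.closure (Function.support μ) = ⊤)
    (hfin : (Function.support μ).Finite) :
    (∀ ε > (0 : ℝ), ∃ ε₁ > (0 : ℝ), ∃ N : ℕ, ∀ n ≥ N,
      1 - ε ≤ prodProb μ n {s : Fin n → Wreath ℤ F |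
        (∃ u : ℤ, ((walkPos s n).left : ℤ → F) u ≠ 1 ∧ (u : ℝ) ≤ -(ε₁ * Real.sqrt n)) ∧
        (∃ v : ℤ, ((walkPos s n).left : ℤ → F) v ≠ 1 ∧ ε₁ * Real.sqrt n ≤ (v : ℝ))}) ∧
    (∀ ε > (0 : ℝ), ∃ ε₁ > (0 : ℝ), ∃ N : ℕ, ∀ n ≥ N,
      1 - ε ≤ prodProb μ n {s : Fin n → Wreath ℤ F |
        (∃ u : ℤ, ((walkPos s n).left : ℤ → F) u ≠ 1 ∧
          (u : ℝ) ≤ ((Multiplicative.toAdd (walkPos s n).right : ℤ) : ℝ) - ε₁ * Real.sqrt n) ∧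
        (∃ v : ℤ, ((walkPos s n).left : ℤ → F) v ≠ 1 ∧
          ((Multiplicative.toAdd (walkPos s n).right : ℤ) : ℝ) + ε₁ * Real.sqrt n ≤ (v : ℝ))}) := by
  have hS : ∀ g, μ g ≠ 0 → g ∈ hfin.toFinset := fun g hg => by simpa using hg
  have hSi : ∀ g, g ∈ hfin.toFinset → g⁻¹ ∈ hfin.toFinset := fun g hg => by
    simp only [Set.Finite.mem_toFinset, Function.mem_support] at hg ⊢
    rwa [← hsym g]
  have h1 : ∑ g ∈ hfin.toFinset, μ g = 1 := by
    rw [← hμ1.tsum_eq]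
    exact (tsum_eq_sum fun g hg => by simpa using hg).symm
  have key := twosided μ hfin.toFinset hμ0 h1 hS hSi hsym hnd
  refine ⟨fun ε hε => ?_, fun ε hε => ?_⟩
  · obtain ⟨ε₁, he, N, hN⟩ := key ε hε
    refine ⟨ε₁, he, N, fun n hn => ?_⟩
    have := hN n hn
    rw [← prodProb_eq hS] at this
    exact this
  · obtain ⟨ε₁, he, N, hN⟩ := key ε hε
    refine ⟨ε₁, he, N, fun n hn => ?_⟩
    have := hN n hn
    rw [← TP_inv_one hSi hsym] at this
    have e : (fun Y => ind (Good (F := F) (ε₁ * Real.sqrt n)) Y⁻¹) =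
        ind (fun Y => Good (F := F) (ε₁ * Real.sqrt n) Y⁻¹) := rfl
    rw [e, ← prodProb_eq hS] at this
    refine this.trans (le_of_eq ?_)
    congr 1
    ext s
    simp only [Set.mem_setOf_eq, Good, left_inv_apply, ne_eq, inv_eq_one]
    generalize Multiplicative.toAdd (walkPos s n).right = x
    constructor
    · rintro ⟨⟨u, hu, hu'⟩, ⟨v, hv, hv'⟩⟩
      exact ⟨⟨u + x, hu, by push_cast; linarith⟩, ⟨v + x, hv, by push_cast; linarith⟩⟩
    · rintro ⟨⟨u, hu, hu'⟩, ⟨v, hv, hv'⟩⟩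
      exact ⟨⟨u - x, by simpa using hu, by push_cast; linarith⟩,
        ⟨v - x, by simpa using hv, by push_cast; linarith⟩⟩
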